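/- Let n ≥ 2, μ ∈ ℝ^{n+1}, and σ ∈ Γ_{C^t}(μ). Let l₀ ≥ 0 with l₀ + 1 ≤ n, and set μ̄_i = μ_i − (1/2)∑_{t∈I} K^c_{it} σ_t for i ∈ I. Let f be a bijection of {0, 1, …, 2l₀+1} satisfying f(j) + f(2l₀+1−j) = 2l₀+1 for all 0 ≤ j ≤ 2l₀+1. Define μ̂_r = μ̄_{l₀+2−r} for 1 ≤ r ≤ l₀+1 and μ̂_r = μ̄_{r−l₀} for l₀+2 ≤ r ≤ 2l₀+1. Define σ_f ∈ ℝ^{n+1} by σ_{f,i} = σ_i + 2∑_{j=0}^{l₀+1−i} ( ∑_{r=1}^{f(j)} μ̂_r − ∑_{r=1}^{j} μ̂_r ) for 1 ≤ i ≤ l₀+1, and σ_{f,i} = σ_i for l₀+2 ≤ i ≤ n+1 (empty sums are 0). Then σ_f ∈ Γ_{C^t}(μ). -/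

import Mathlib

open Finset

/-- The generalized Cartan matrix `K^c` of type `C_n^{(1),t}` (1-based indices in
`{1,…,n+1}`): `K^c_{ii} = 2`, `K^c_{1,2} = K^c_{n+1,n} = -2`,
`K^c_{i,i-1} = K^c_{i,i+1} = -1` for `2 ≤ i ≤ n`, and `0` otherwise. -/
noncomputable def affC (n : ℕ) (i j : ℕ) : ℝ :=
  if i = j then 2
  else if (i = 1 ∧ j = 2) ∨ (i = n + 1 ∧ j = n) then -2
  else if 2 ≤ i ∧ i ≤ n ∧ (j = i - 1 ∨ j = i + 1) then -1
  else 0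

/-- The affine reflection `ℜ_i` associated to `μ`:
`(ℜ_i σ)_i = 2 μ_i - ∑_{t∈I} K^c_{it} σ_t + σ_i`, other coordinates unchanged. -/
noncomputable def reflC (n : ℕ) (μ : ℕ → ℝ) (i : ℕ) (σ : ℕ → ℝ) : ℕ → ℝ :=
  Function.update σ i
    (2 * μ i - ∑ t ∈ Finset.Icc 1 (n + 1), affC n i t * σ t + σ i)

/-- `Γ_{C^t}(μ)`: the smallest set containing `0` and closed under all `ℜ_i`, `i ∈ I`. -/
inductive GammaC (n : ℕ) (μ : ℕ → ℝ) : (ℕ → ℝ) → Prop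
  | zero : GammaC n μ 0
  | refl (i : ℕ) (hi : i ∈ Finset.Icc 1 (n + 1)) (σ : ℕ → ℝ) :
      GammaC n μ σ → GammaC n μ (reflC n μ i σ)

theorem sum_affC_one (n : ℕ) (hn : 2 ≤ n) (x : ℕ → ℝ) :
    ∑ t ∈ Finset.Icc 1 (n + 1), affC n 1 t * x t = 2 * x 1 - 2 * x 2 := by
  have hsub : ({1, 2} : Finset ℕ) ⊆ Finset.Icc 1 (n + 1) := by
    intro t ht
    simp only [Finset.mem_insert, Finset.mem_singleton] at ht
    simp only [Finset.mem_Icc]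
    omega
  rw [← Finset.sum_subset hsub, Finset.sum_pair (by omega)]
  · simp [affC]
    ring
  · intro t _ ht
    simp only [Finset.mem_insert, Finset.mem_singleton] at ht
    have : affC n 1 t = 0 := by
      unfold affC
      rw [if_neg (by omega), if_neg (by omega), if_neg (by omega)]
    rw [this, zero_mul]

theorem sum_affC_succ (n i : ℕ) (hi : 1 ≤ i) (hin : i + 1 ≤ n) (x : ℕ → ℝ) :
    ∑ t ∈ Finset.Icc 1 (n + 1), affC n (i + 1) t * x t =
      2 * x (i + 1) - x i - x (i + 2) := by
  have hsub : ({i, i + 1, i + 2} : Finset ℕ) ⊆ Finset.Icc 1 (n + 1) := by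
    intro t ht
    simp only [Finset.mem_insert, Finset.mem_singleton] at ht
    simp only [Finset.mem_Icc]
    omega
  rw [← Finset.sum_subset hsub, Finset.sum_insert (by simp), Finset.sum_pair (by omega)]
  · have h₁ : affC n (i + 1) i = -1 := by
      unfold affC
      rw [if_neg (by omega), if_neg (by omega), if_pos (by omega)]
    have h₂ : affC n (i + 1) (i + 1) = 2 := by simp [affC]
    have h₃ : affC n (i + 1) (i + 2) = -1 := by
      unfold affC
      rw [if_neg (by omega), if_neg (by omega), if_pos (by omega)]
    rw [h₁, h₂, h₃]
    ring
  · intro t _ ht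
    simp only [Finset.mem_insert, Finset.mem_singleton] at ht
    have : affC n (i + 1) t = 0 := by
      unfold affC
      rw [if_neg (by omega), if_neg (by omega), if_neg (by omega)]
    rw [this, zero_mul]

/-- The vector obtained from `σ` by adding twice the partial sums of `h - P`. -/
noncomputable def partialSumShift (l : ℕ) (σ P h : ℕ → ℝ) (i : ℕ) : ℝ :=
  if i = 0 then σ 0 else σ i + 2 * ∑ j ∈ Finset.range (l + 2 - i), (h j - P j)

theorem partialSumShift_self (l : ℕ) (σ P : ℕ → ℝ) : partialSumShift l σ P P = σ := by
  funext i
  unfold partialSumShift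
  split_ifs with hi
  · rw [hi]
  · simp

theorem partialSumShift_congr {l : ℕ} {σ P h h' : ℕ → ℝ} (H : ∀ j ≤ l, h j = h' j) :
    partialSumShift l σ P h = partialSumShift l σ P h' := by
  funext i
  unfold partialSumShift
  split_ifs with hi
  · rfl
  · congr 2
    refine Finset.sum_congr rfl fun j hj => ?_
    rw [H j (by have := Finset.mem_range.1 hj; omega)]

theorem sum_range_comp_swap (h : ℕ → ℝ) (k m : ℕ) (hm : m ≠ k + 1) :
    ∑ j ∈ Finset.range m, h (Equiv.swap k (k + 1) j) = ∑ j ∈ Finset.range m, h j := by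
  refine Finset.sum_equiv (Equiv.swap k (k + 1)) (fun j => ?_) (fun _ _ => rfl)
  simp only [Finset.mem_range, Equiv.swap_apply_def]
  split_ifs <;> omega

theorem reflC_partialSumShift_swap (n l k : ℕ) (hl : l + 1 ≤ n) (hk : k < l)
    (μ σ P h : ℕ → ℝ)
    (hP : 2 * μ (l - k + 1) - ∑ t ∈ Finset.Icc 1 (n + 1), affC n (l - k + 1) t * σ t =
      2 * (P (k + 1) - P k)) :
    reflC n μ (l - k + 1) (partialSumShift l σ P h) =
      partialSumShift l σ P (h ∘ Equiv.swap k (k + 1)) := by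
  rw [sum_affC_succ n (l - k) (by omega) (by omega)] at hP
  funext i
  unfold reflC
  rw [sum_affC_succ n (l - k) (by omega) (by omega)]
  by_cases hi : i = l - k + 1
  · subst hi
    rw [Function.update_self]
    unfold partialSumShift
    rw [if_neg (by omega), if_neg (by omega), if_neg (by omega), if_neg (by omega),
      show l + 2 - (l - k + 1) = k + 1 by omega, show l + 2 - (l - k) = k + 2 by omega,
      show l + 2 - (l - k + 2) = k by omega]
    simp only [Finset.sum_sub_distrib, Function.comp_apply]
    rw [Finset.sum_range_succ (fun j => h (Equiv.swap k (k + 1) j)),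
      sum_range_comp_swap h k k (by omega), Equiv.swap_apply_left]
    simp only [Finset.sum_range_succ]
    linarith
  · rw [Function.update_of_ne hi]
    unfold partialSumShift
    split_ifs with h0
    · rfl
    · simp only [Finset.sum_sub_distrib, Function.comp_apply]
      rw [sum_range_comp_swap h k _ (by omega)]

theorem reflC_partialSumShift_update (n l : ℕ) (hn : 2 ≤ n)
    (μ σ P h : ℕ → ℝ) (T : ℝ)
    (hP : 2 * μ 1 - ∑ t ∈ Finset.Icc 1 (n + 1), affC n 1 t * σ t = 2 * (T - 2 * P l)) :
    reflC n μ 1 (partialSumShift l σ P h) =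
      partialSumShift l σ P (Function.update h l (T - h l)) := by
  rw [sum_affC_one n hn] at hP
  have hupd : ∀ m ≤ l, ∑ j ∈ Finset.range m, Function.update h l (T - h l) j =
      ∑ j ∈ Finset.range m, h j := fun m hm =>
    Finset.sum_congr rfl fun j hj =>
      Function.update_of_ne (by have := Finset.mem_range.1 hj; omega) _ _
  funext i
  unfold reflC
  rw [sum_affC_one n hn]
  by_cases hi : i = 1
  · subst hi
    rw [Function.update_self]
    unfold partialSumShift
    rw [if_neg (by omega), if_neg (by omega), if_neg (by omega),
      show l + 2 - 1 = l + 1 by omega, show l + 2 - 2 = l by omega]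
    simp only [Finset.sum_sub_distrib]
    rw [Finset.sum_range_succ (Function.update h l (T - h l)), hupd l le_rfl,
      Function.update_self]
    simp only [Finset.sum_range_succ]
    linarith
  · rw [Function.update_of_ne hi]
    unfold partialSumShift
    split_ifs with h0
    · rfl
    · simp only [Finset.sum_sub_distrib]
      rw [hupd _ (by omega)]

/-- A weight that drops whenever two adjacent decreasing values are exchanged, or the last value is
lowered. -/
def staircaseWeight (l : ℕ) (g : ℕ → ℕ) : ℕ :=
  ∑ m ∈ Finset.range (l + 2), ∑ j ∈ Finset.range m, g j

theorem staircaseWeight_swap_lt {l k : ℕ} (hk : k < l) {g : ℕ → ℕ} (hg : g (k + 1) < g k) :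
    staircaseWeight l (g ∘ Equiv.swap k (k + 1)) < staircaseWeight l g := by
  have key : ∀ m, m ≠ k + 1 → ∑ j ∈ Finset.range m, (g ∘ Equiv.swap k (k + 1)) j =
      ∑ j ∈ Finset.range m, g j := by
    intro m hm
    have := sum_range_comp_swap (fun j => (g j : ℝ)) k m hm
    exact_mod_cast this
  have hlt : ∑ j ∈ Finset.range (k + 1), (g ∘ Equiv.swap k (k + 1)) j <
      ∑ j ∈ Finset.range (k + 1), g j := by
    rw [Finset.sum_range_succ, Finset.sum_range_succ, key k (by omega)]
    simpa using hg
  refine Finset.sum_lt_sum (fun m _ => ?_) ⟨k + 1, Finset.mem_range.2 (by omega), hlt⟩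
  by_cases hm : m = k + 1
  · rw [hm]
    exact hlt.le
  · exact (key m hm).le

theorem staircaseWeight_update_lt {l v : ℕ} {g : ℕ → ℕ} (hv : v < g l) :
    staircaseWeight l (Function.update g l v) < staircaseWeight l g := by
  have hle : ∀ j, Function.update g l v j ≤ g j := by
    intro j
    by_cases hj : j = l
    · subst hj
      simpa using hv.le
    · rw [Function.update_of_ne hj]
  refine Finset.sum_lt_sum (fun m _ => Finset.sum_le_sum fun j _ => hle j)
    ⟨l + 1, Finset.mem_range.2 (by omega), ?_⟩
  exact Finset.sum_lt_sum (fun j _ => hle j) ⟨l, Finset.mem_range.2 (by omega), by simpa using hv⟩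

theorem eq_self_of_injOn_of_monotone {l : ℕ} {g : ℕ → ℕ}
    (hinj : ∀ j ≤ l, ∀ k ≤ l, g j = g k → j = k)
    (hmono : ∀ k < l, g k ≤ g (k + 1)) (hlast : g l ≤ l) : ∀ j ≤ l, g j = j := by
  have hstrict : ∀ k < l, g k < g (k + 1) := fun k hk =>
    lt_of_le_of_ne (hmono k hk) fun h => by
      have := hinj k hk.le (k + 1) hk h
      omega
  have hlow : ∀ j ≤ l, j ≤ g j := by
    intro j
    induction j with
    | zero => intro _; exact Nat.zero_le _
    | succ j ih =>
      intro hj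
      have := ih (by omega)
      have := hstrict j (by omega)
      omega
  have hhigh : ∀ d ≤ l, g (l - d) ≤ l - d := by
    intro d
    induction d with
    | zero => intro _; simpa using hlast
    | succ d ih =>
      intro hd
      have h₁ := ih (by omega)
      have h₂ := hstrict (l - (d + 1)) (by omega)
      rw [show l - (d + 1) + 1 = l - d by omega] at h₂
      omega
  intro j hj
  have h₁ := hlow j hj
  have h₂ := hhigh (l - j) (by omega)
  rw [show l - (l - j) = j by omega] at h₂
  omega

theorem gammaC_partialSumShift (n l : ℕ) (hn : 2 ≤ n) (hl : l + 1 ≤ n) (μ σ P : ℕ → ℝ)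
    (hσ : GammaC n μ σ)
    (hP : ∀ k < l, 2 * μ (l - k + 1) -
      ∑ t ∈ Finset.Icc 1 (n + 1), affC n (l - k + 1) t * σ t = 2 * (P (k + 1) - P k))
    (hPl : 2 * μ 1 - ∑ t ∈ Finset.Icc 1 (n + 1), affC n 1 t * σ t =
      2 * (P (2 * l + 1) - 2 * P l))
    (hPsymm : ∀ j ≤ 2 * l + 1, P j + P (2 * l + 1 - j) = P (2 * l + 1))
    (g : ℕ → ℕ) (hg : ∀ j ≤ l, g j ≤ 2 * l + 1)
    (hinj : ∀ j ≤ l, ∀ k ≤ l, g j = g k → j = k)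
    (hne : ∀ j ≤ l, ∀ k ≤ l, g j + g k ≠ 2 * l + 1) :
    GammaC n μ (partialSumShift l σ P (P ∘ g)) := by
  induction hw : staircaseWeight l g using Nat.strong_induction_on generalizing g with
  | _ w ih =>
    subst hw
    by_cases hdesc : ∃ k < l, g (k + 1) < g k
    · obtain ⟨k, hk, hlt⟩ := hdesc
      have hle : ∀ j ≤ l, Equiv.swap k (k + 1) j ≤ l := by
        intro j hj
        rw [Equiv.swap_apply_def]
        split_ifs <;> omega
      have hrec := ih _ (staircaseWeight_swap_lt hk hlt) (g ∘ Equiv.swap k (k + 1))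
        (fun j hj => hg _ (hle j hj))
        (fun i hi j hj hij => (Equiv.swap k (k + 1)).injective
          (hinj _ (hle i hi) _ (hle j hj) hij))
        (fun i hi j hj => hne _ (hle i hi) _ (hle j hj)) rfl
      have hrefl := GammaC.refl (l - k + 1) (Finset.mem_Icc.2 (by omega)) _ hrec
      rw [reflC_partialSumShift_swap n l k hl hk μ σ P _ (hP k hk)] at hrefl
      convert hrefl using 2
      funext j
      simp
    · by_cases hlast : g l ≤ l
      · have hid := eq_self_of_injOn_of_monotone hinj
          (fun k hk => not_lt.1 fun h => hdesc ⟨k, hk, h⟩) hlast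
        rw [partialSumShift_congr (h' := P) fun j hj => by simp [hid j hj],
          partialSumShift_self]
        exact hσ
      · have hgl := hg l le_rfl
        have hrec := ih _ (staircaseWeight_update_lt (v := 2 * l + 1 - g l) (by omega))
          (Function.update g l (2 * l + 1 - g l))
          (fun j hj => by
            have := hg j hj
            rw [Function.update_apply]
            split_ifs <;> omega)
          (fun i hi j hj => by
            have h₁ := hinj i hi j hj
            have h₂ := hne i hi l le_rfl
            have h₃ := hne j hj l le_rfl
            rw [Function.update_apply, Function.update_apply]
            split_ifs <;> omega)
          (fun i hi j hj => by
            have h₁ := hne i hi j hj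
            have h₂ := hinj i hi l le_rfl
            have h₃ := hinj j hj l le_rfl
            rw [Function.update_apply, Function.update_apply]
            split_ifs <;> omega) rfl
        have hrefl := GammaC.refl 1 (Finset.mem_Icc.2 (by omega)) _ hrec
        rw [reflC_partialSumShift_update n l hn μ σ P _ _ hPl] at hrefl
        convert hrefl using 2
        funext j
        by_cases hj : j = l
        · subst hj
          have := hPsymm (g j) hgl
          simp only [Function.comp_apply, Function.update_self]
          linarith
        · simp [Function.update_of_ne hj]

/-- If `σ ∈ Γ_{C^t}(μ)`, `μ̄_i = μ_i - ½ ∑_t K^c_{it} σ_t`, `f` is an involution-symmetric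
bijection of `{0,…,2l₀+1}` (`f(j) + f(2l₀+1-j) = 2l₀+1`), `μ̂_r = μ̄_{l₀+2-r}` for
`r ≤ l₀+1` and `μ̂_r = μ̄_{r-l₀}` for `l₀+2 ≤ r ≤ 2l₀+1`, then the vector `σ_f` with
`σ_{f,i} = σ_i + 2∑_{j=0}^{l₀+1-i}(∑_{r=1}^{f(j)} μ̂_r - ∑_{r=1}^{j} μ̂_r)` for
`1 ≤ i ≤ l₀+1` and `σ_{f,i} = σ_i` otherwise also belongs to `Γ_{C^t}(μ)`. -/
theorem gammaC_symmetric_permutation_step (n : ℕ) (hn : 2 ≤ n) (μ σ : ℕ → ℝ)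
    (hσ : GammaC n μ σ) (l0 : ℕ) (hl0 : l0 + 1 ≤ n)
    (mubar : ℕ → ℝ)
    (hmubar : ∀ i : ℕ, mubar i =
      μ i - (1 / 2) * ∑ t ∈ Finset.Icc 1 (n + 1), affC n i t * σ t)
    (f : ℕ → ℕ)
    (hfbij : Set.BijOn f (Set.Iic (2 * l0 + 1)) (Set.Iic (2 * l0 + 1)))
    (hfsym : ∀ j ≤ 2 * l0 + 1, f j + f (2 * l0 + 1 - j) = 2 * l0 + 1)
    (muhat : ℕ → ℝ)
    (hmuhat1 : ∀ r : ℕ, 1 ≤ r → r ≤ l0 + 1 → muhat r = mubar (l0 + 2 - r))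
    (hmuhat2 : ∀ r : ℕ, l0 + 2 ≤ r → r ≤ 2 * l0 + 1 → muhat r = mubar (r - l0))
    (σf : ℕ → ℝ)
    (hσf1 : ∀ i : ℕ, 1 ≤ i → i ≤ l0 + 1 →
      σf i = σ i + 2 * ∑ j ∈ Finset.range (l0 + 2 - i),
        (∑ r ∈ Finset.Icc 1 (f j), muhat r - ∑ r ∈ Finset.Icc 1 j, muhat r))
    (hσf2 : ∀ i : ℕ, ¬(1 ≤ i ∧ i ≤ l0 + 1) → σf i = σ i) :
    GammaC n μ σf := by
  have hP_succ : ∀ k, ∑ r ∈ Finset.Icc 1 (k + 1), muhat r =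
      ∑ r ∈ Finset.Icc 1 k, muhat r + muhat (k + 1) := fun k =>
    Finset.sum_Icc_succ_top (by omega) _
  have hsymm : ∀ r, 1 ≤ r → r ≤ 2 * l0 + 1 → muhat r = muhat (2 * l0 + 2 - r) := by
    intro r h₁ h₂
    rcases lt_trichotomy r (l0 + 1) with h | h | h
    · rw [hmuhat1 r h₁ h.le, hmuhat2 _ (by omega) (by omega)]
      congr 1
      omega
    · congr 1
      omega
    · rw [hmuhat2 r h h₂, hmuhat1 _ (by omega) (by omega)]
      congr 1
      omega
  have hPsymm : ∀ j ≤ 2 * l0 + 1, ∑ r ∈ Finset.Icc 1 j, muhat r +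
      ∑ r ∈ Finset.Icc 1 (2 * l0 + 1 - j), muhat r =
        ∑ r ∈ Finset.Icc 1 (2 * l0 + 1), muhat r := by
    intro j
    induction j with
    | zero => simp
    | succ j ih =>
      intro hj
      have h₁ := ih (by omega)
      have h₂ := hsymm (j + 1) (by omega) hj
      have h₃ := hP_succ (2 * l0 + 1 - (j + 1))
      rw [show 2 * l0 + 1 - (j + 1) + 1 = 2 * l0 + 1 - j by omega] at h₃
      rw [show 2 * l0 + 2 - (j + 1) = 2 * l0 + 1 - j by omega] at h₂
      rw [hP_succ j]
      linarith
  have hmem := gammaC_partialSumShift n l0 hn hl0 μ σ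
    (fun k => ∑ r ∈ Finset.Icc 1 k, muhat r) hσ
    (fun k hk => by
      have h₁ := hmuhat1 (k + 1) (by omega) (by omega)
      rw [show l0 + 2 - (k + 1) = l0 - k + 1 by omega, hmubar] at h₁
      have h₂ := hP_succ k
      linarith)
    (by
      have h₁ := hmuhat1 (l0 + 1) (by omega) le_rfl
      rw [show l0 + 2 - (l0 + 1) = 1 by omega, hmubar] at h₁
      have h₂ := hP_succ l0
      have h₃ := hPsymm l0 (by omega)
      rw [show 2 * l0 + 1 - l0 = l0 + 1 by omega] at h₃
      linarith)
    hPsymm f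
    (fun j hj => hfbij.mapsTo (Set.mem_Iic.2 (by omega)))
    (fun j hj k hk h => hfbij.injOn (Set.mem_Iic.2 (by omega)) (Set.mem_Iic.2 (by omega)) h)
    (fun j hj k hk h => by
      have h₁ := hfsym j (by omega)
      have h₂ : k = 2 * l0 + 1 - j :=
        hfbij.injOn (Set.mem_Iic.2 (by omega)) (Set.mem_Iic.2 (by omega)) (by omega)
      omega)
  convert hmem using 1
  funext i
  unfold partialSumShift
  by_cases hi : 1 ≤ i ∧ i ≤ l0 + 1
  · rw [if_neg (by omega), hσf1 i hi.1 hi.2]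
    rfl
  · rw [hσf2 i hi]
    split_ifs with h0
    · rw [h0]
    · rw [show l0 + 2 - i = 0 by omega]
      simp
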